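/- arXiv:2308.01504 — 2 statements merged into one kernel-verified Lean document; each statement's English description precedes it below -/
import Mathlib

section
/- Let G = N ⋊_φ H be a semidirect product of finite groups that is D-quasirandom on N for some real D > 0. Then for all subsets X, Y ⊆ G, writing E(X,Y) = #{(x₁,x₂,y₁,y₂) ∈ X²×Y² : x₁y₁ = x₂y₂} and Ė(X,Y) = #{(x₁,x₂,y₁,y₂) ∈ X²×Y² : ẋ₁ẏ₁ = ẋ₂ẏ₂}, one has (|H|/|G|)·Ė(X,Y) ≤ E(X,Y) ≤ (|H|/|G|)·Ė(X,Y) + (|G|/D)·|X||Y|. -/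
/-- A representation is irreducible if the space is nontrivial and the only
invariant subspaces are `⊥` and `⊤`. -/
def IsIrreducibleRep {G V : Type*} [Group G] [AddCommGroup V] [Module ℂ V]
    (ρ : Representation ℂ G V) : Prop :=
  Nontrivial V ∧ ∀ W : Submodule ℂ V, (∀ g : G, ∀ v ∈ W, ρ g v ∈ W) → W = ⊥ ∨ W = ⊤

/-- `G = N ⋊[φ] H` is `D`-quasirandom on `N`: every irreducible complex representation
of `G` of type II (i.e. one that is nontrivial on `N × {1}`) has degree at least `D`. -/
def QuasirandomOn {N H : Type} [Group N] [Group H] (φ : H →* MulAut N) (D : ℝ) : Prop :=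
  ∀ (V : Type) [AddCommGroup V] [Module ℂ V] [FiniteDimensional ℂ V]
    (ρ : Representation ℂ (N ⋊[φ] H) V), IsIrreducibleRep ρ →
    (∃ z : N, ρ (SemidirectProduct.inl z) ≠ 1) → D ≤ (Module.finrank ℂ V : ℝ)

/-- Every nonzero invariant subspace of a finite-dimensional representation contains an
irreducible subrepresentation. -/
theorem exists_irreducible_subrepresentation {G V : Type*} [Group G] [AddCommGroup V] [Module ℂ V]
    [FiniteDimensional ℂ V] (ρ : Representation ℂ G V) (W : Submodule ℂ V) (hW : W ≠ ⊥)
    (hinv : ∀ g, W ≤ W.comap (ρ g)) :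
    ∃ U ≤ W, ∃ hU : ∀ g, U ≤ U.comap (ρ g), IsIrreducibleRep (ρ.subrepresentation U hU) := by
  obtain ⟨U, ⟨hUW, hU0, hU⟩, hmin⟩ := (wellFounded_lt (α := Submodule ℂ V)).has_min
    {U | U ≤ W ∧ U ≠ ⊥ ∧ ∀ g, U ≤ U.comap (ρ g)} ⟨W, le_rfl, hW, hinv⟩
  refine ⟨U, hUW, hU, Submodule.nontrivial_iff_ne_bot.2 hU0, fun S hS => ?_⟩
  by_cases hS0 : S = ⊥
  · exact Or.inl hS0
  right
  have hle : S.map U.subtype ≤ U := Submodule.map_subtype_le U S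
  have hinvS : ∀ g, S.map U.subtype ≤ (S.map U.subtype).comap (ρ g) := by
    rintro g _ ⟨v, hv, rfl⟩
    exact ⟨_, hS g v hv, rfl⟩
  have hne : S.map U.subtype ≠ ⊥ := fun h =>
    hS0 (Submodule.map_injective_of_injective U.subtype_injective (h.trans (Submodule.map_bot _).symm))
  have heq : S.map U.subtype = U :=
    hle.eq_of_not_lt (hmin _ ⟨hle.trans hUW, hne, hinvS⟩)
  exact Submodule.map_injective_of_injective U.subtype_injective (by simpa using heq)

section Spectral

open scoped Matrix InnerProductSpace ComplexOrder

variable {ι : Type*} [Fintype ι] [DecidableEq ι]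

theorem inner_eigenvectorBasis_mulVec {A : Matrix ι ι ℂ} (hA : A.IsHermitian) (f : ι → ℂ) (j : ι) :
    ⟪hA.eigenvectorBasis j, WithLp.toLp 2 (A *ᵥ f)⟫_ℂ =
      hA.eigenvalues j * ⟪hA.eigenvectorBasis j, WithLp.toLp 2 f⟫_ℂ := by
  have h := congrArg star (hA.mulVec_eigenvectorBasis j)
  rw [Matrix.star_mulVec, hA.eq] at h
  simp only [EuclideanSpace.inner_eq_star_dotProduct]
  rw [dotProduct_comm, Matrix.dotProduct_mulVec, h, dotProduct_comm (f : ι → ℂ)]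
  simp [smul_dotProduct]

/-- The dimension of an eigenspace of a Hermitian matrix is at most the number of its eigenvalues,
with multiplicity, that are equal to the given one. -/
theorem finrank_eigenspace_le_card_eigenvalues {A : Matrix ι ι ℂ} (hA : A.IsHermitian) (μ : ℝ) :
    Module.finrank ℂ (Module.End.eigenspace (Matrix.toLin' A) (μ : ℂ)) ≤
      Fintype.card {j // hA.eigenvalues j = μ} := by
  let L : (ι → ℂ) →ₗ[ℂ] ({j // hA.eigenvalues j = μ} → ℂ) :=
    LinearMap.pi fun j => (innerₛₗ ℂ (hA.eigenvectorBasis j)).comp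
      (WithLp.linearEquiv 2 ℂ (ι → ℂ)).symm.toLinearMap
  have hL : Function.Injective (L.comp (Module.End.eigenspace (Matrix.toLin' A) (μ : ℂ)).subtype) := by
    rw [← LinearMap.ker_eq_bot, LinearMap.ker_eq_bot']
    rintro ⟨f, hf⟩ hLf
    have hf' : A *ᵥ f = (μ : ℂ) • f := by simpa using Module.End.mem_eigenspace_iff.1 hf
    have hc : ∀ j, ⟪hA.eigenvectorBasis j, WithLp.toLp 2 f⟫_ℂ = 0 := by
      intro j
      by_cases hj : hA.eigenvalues j = μ
      · exact congrFun hLf ⟨j, hj⟩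
      · have h := inner_eigenvectorBasis_mulVec hA f j
        rw [hf', WithLp.toLp_smul, inner_smul_right] at h
        have h' : ((hA.eigenvalues j : ℂ) - μ) * ⟪hA.eigenvectorBasis j, WithLp.toLp 2 f⟫_ℂ = 0 := by
          rw [sub_mul, h, sub_self]
        exact (mul_eq_zero.1 h').resolve_left (sub_ne_zero.2 (by exact_mod_cast hj))
    have h0 : WithLp.toLp 2 f = (0 : EuclideanSpace ℂ ι) :=
      hA.eigenvectorBasis.repr.injective (by
        ext j
        simpa [OrthonormalBasis.repr_apply_apply] using hc j)
    exact Subtype.ext (by simpa using h0)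
  simpa using LinearMap.finrank_le_finrank_of_injective hL

/-- If every nonzero eigenvalue of `Mᴴ * M` has multiplicity at least `D`, then the operator norm of
`M` is controlled by its Hilbert–Schmidt norm with a gain of `D`. -/
theorem mul_sum_sq_mulVec_le {M : Matrix ι ι ℂ} {D : ℝ}
    (hD : ∀ μ : ℂ, μ ≠ 0 → Module.End.HasEigenvalue (Matrix.toLin' (Mᴴ * M)) μ →
      D ≤ Module.finrank ℂ (Module.End.eigenspace (Matrix.toLin' (Mᴴ * M)) μ))
    (f : ι → ℂ) :
    D * ∑ i, ‖(M *ᵥ f) i‖ ^ 2 ≤ (∑ i, ∑ j, ‖M i j‖ ^ 2) * ∑ i, ‖f i‖ ^ 2 := by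
  have hP : (Mᴴ * M).PosSemidef := Matrix.posSemidef_conjTranspose_mul_self M
  have hA := hP.isHermitian
  set b := hA.eigenvectorBasis with hb
  have htr : ∑ j, hA.eigenvalues j = ∑ i, ∑ j, ‖M i j‖ ^ 2 := by
    apply Complex.ofReal_injective
    rw [Finset.sum_comm, Complex.ofReal_sum]
    refine hA.trace_eq_sum_eigenvalues.symm.trans ?_
    simp [Matrix.trace, Matrix.mul_apply, Complex.conj_mul']
  have hquad : ∑ i, ‖(M *ᵥ f) i‖ ^ 2 =
      ∑ j, hA.eigenvalues j * ‖⟪b j, WithLp.toLp 2 f⟫_ℂ‖ ^ 2 := by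
    have h := b.sum_inner_mul_inner (WithLp.toLp 2 f) (WithLp.toLp 2 ((Mᴴ * M) *ᵥ f))
    have h2 : ⟪WithLp.toLp 2 f, WithLp.toLp 2 ((Mᴴ * M) *ᵥ f)⟫_ℂ =
        ((∑ i, ‖(M *ᵥ f) i‖ ^ 2 : ℝ) : ℂ) := by
      rw [EuclideanSpace.inner_eq_star_dotProduct, dotProduct_comm, ← Matrix.mulVec_mulVec,
        Matrix.dotProduct_mulVec, ← Matrix.star_mulVec]
      simp [dotProduct, Complex.conj_mul']
    apply Complex.ofReal_injective
    rw [← h2, ← h]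
    push_cast
    refine Finset.sum_congr rfl fun j _ => ?_
    rw [hb, inner_eigenvectorBasis_mulVec, ← inner_conj_symm, ← Complex.conj_mul']
    ring
  have hnorm : ∑ j, ‖⟪b j, WithLp.toLp 2 f⟫_ℂ‖ ^ 2 = ∑ i, ‖f i‖ ^ 2 := by
    rw [b.sum_sq_norm_inner_right, EuclideanSpace.norm_sq_eq]
  have hev : ∀ j, D * hA.eigenvalues j ≤ ∑ i, ∑ j, ‖M i j‖ ^ 2 := by
    intro j
    rw [← htr]
    by_cases hj : hA.eigenvalues j = 0
    · rw [hj, mul_zero]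
      exact Finset.sum_nonneg fun i _ => hP.eigenvalues_nonneg i
    have heig : Module.End.HasEigenvalue (Matrix.toLin' (Mᴴ * M)) (hA.eigenvalues j : ℂ) := by
      refine Module.End.hasEigenvalue_of_hasEigenvector (x := WithLp.ofLp (b j)) ⟨?_, ?_⟩
      · rw [Module.End.mem_eigenspace_iff, Matrix.toLin'_apply, hb, hA.mulVec_eigenvectorBasis]
        ext i
        simp
      · intro h
        exact b.toBasis.ne_zero j (by simpa using h)
    have h1 := hD _ (by exact_mod_cast hj) heig
    have h2 : (Module.finrank ℂ (Module.End.eigenspace (Matrix.toLin' (Mᴴ * M))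
        (hA.eigenvalues j : ℂ)) : ℝ) ≤ Fintype.card {i // hA.eigenvalues i = hA.eigenvalues j} := by
      exact_mod_cast finrank_eigenspace_le_card_eigenvalues hA _
    calc D * hA.eigenvalues j
        ≤ Fintype.card {i // hA.eigenvalues i = hA.eigenvalues j} * hA.eigenvalues j :=
          mul_le_mul_of_nonneg_right (h1.trans h2) (hP.eigenvalues_nonneg j)
      _ = ∑ i with hA.eigenvalues i = hA.eigenvalues j, hA.eigenvalues i := by
          rw [Finset.sum_congr rfl fun i hi => (Finset.mem_filter.1 hi).2, Finset.sum_const,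
            nsmul_eq_mul, Fintype.card_subtype]
      _ ≤ ∑ i, hA.eigenvalues i :=
          Finset.sum_le_sum_of_subset_of_nonneg (Finset.filter_subset _ _)
            fun i _ _ => hP.eigenvalues_nonneg i
  rw [hquad, ← hnorm, Finset.mul_sum, Finset.mul_sum]
  refine Finset.sum_le_sum fun j _ => ?_
  rw [← mul_assoc]
  exact mul_le_mul_of_nonneg_right (hev j) (by positivity)

end Spectral

/-- The right regular representation of a group on its complex-valued functions. -/
def rightRegular (G : Type*) [Group G] : Representation ℂ G (G → ℂ) where
  toFun a := LinearMap.funLeft ℂ ℂ (· * a)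
  map_one' := by ext; simp [LinearMap.funLeft]
  map_mul' a b := by ext; simp [LinearMap.funLeft, mul_assoc]

open Classical in
/-- The number of collisions of a map on `X × Y` is the sum of the squares of its fibre sizes. -/
theorem card_collisions {G K : Type*} [Fintype G] [Fintype K] (X Y : Set G) (m : G → G → K) :
    (Nat.card {p : (G × G) × (G × G) // p.1.1 ∈ X ∧ p.1.2 ∈ X ∧ p.2.1 ∈ Y ∧ p.2.2 ∈ Y ∧
      m p.1.1 p.2.1 = m p.1.2 p.2.2} : ℝ) =
    ∑ c, (∑ x, ∑ y, if m x y = c then X.indicator 1 x * Y.indicator 1 y else (0 : ℝ)) ^ 2 := by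
  have hsq : ∀ c, (∑ x, ∑ y, if m x y = c then X.indicator 1 x * Y.indicator 1 y else (0 : ℝ)) ^ 2 =
      ∑ x₁, ∑ x₂, ∑ y₁, ∑ y₂,
        if m x₁ y₁ = c ∧ m x₂ y₂ = c then X.indicator 1 x₁ * X.indicator 1 x₂ *
          (Y.indicator 1 y₁ * Y.indicator 1 y₂) else (0 : ℝ) := by
    intro c
    rw [sq, Finset.sum_mul_sum]
    refine Finset.sum_congr rfl fun x₁ _ => Finset.sum_congr rfl fun x₂ _ => ?_
    rw [Finset.sum_mul_sum]
    refine Finset.sum_congr rfl fun y₁ _ => Finset.sum_congr rfl fun y₂ _ => ?_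
    by_cases h₁ : m x₁ y₁ = c <;> by_cases h₂ : m x₂ y₂ = c <;> simp [h₁, h₂]
    ring
  rw [Nat.card_eq_fintype_card, Fintype.card_subtype, Finset.card_filter, Nat.cast_sum]
  simp only [hsq]
  symm
  rw [Finset.sum_comm, Fintype.sum_prod_type, Fintype.sum_prod_type]
  refine Finset.sum_congr rfl fun x₁ _ => ?_
  rw [Finset.sum_comm]
  refine Finset.sum_congr rfl fun x₂ _ => ?_
  rw [Finset.sum_comm, Fintype.sum_prod_type]
  refine Finset.sum_congr rfl fun y₁ _ => ?_
  rw [Finset.sum_comm]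
  refine Finset.sum_congr rfl fun y₂ _ => ?_
  have hc : ∀ c, (m x₁ y₁ = c ∧ m x₂ y₂ = c) ↔ (m x₁ y₁ = c ∧ m x₁ y₁ = m x₂ y₂) := by
    intro c
    constructor <;> rintro ⟨rfl, h⟩ <;> exact ⟨rfl, h.symm⟩
  simp only [hc, ite_and, Finset.sum_ite_eq, Finset.mem_univ, if_true, Set.indicator_apply]
  by_cases h1 : x₁ ∈ X <;> by_cases h2 : x₂ ∈ X <;> by_cases h3 : y₁ ∈ Y <;>
    by_cases h4 : y₂ ∈ Y <;> simp [h1, h2, h3, h4]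

theorem sum_indicator_sq {G : Type*} [Fintype G] (X : Set G) :
    ∑ g, X.indicator (1 : G → ℝ) g ^ 2 = (Nat.card X : ℝ) := by
  classical
  rw [Nat.card_eq_fintype_card, Fintype.card_subtype, Finset.card_filter]
  push_cast
  refine Finset.sum_congr rfl fun g _ => ?_
  by_cases h : g ∈ X <;> simp [h]

section Semidirect

open scoped Matrix

variable {N H : Type} [Group N] [Group H] [Fintype N] {φ : H →* MulAut N}

/-- The sum of a function over the coset of `N` above `a`. -/
def fiberSum (r : N ⋊[φ] H → ℝ) (a : H) : ℝ := ∑ m : N, r ⟨m, a⟩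

/-- The deviation of a function from its averages over the cosets of `N`. -/
noncomputable def deviation (r : N ⋊[φ] H → ℝ) (g : N ⋊[φ] H) : ℝ :=
  r g - fiberSum r g.right / Fintype.card N

theorem fiberSum_deviation (r : N ⋊[φ] H → ℝ) (a : H) : fiberSum (deviation r) a = 0 := by
  have : (Fintype.card N : ℝ) ≠ 0 := by simp
  simp only [fiberSum, deviation, Finset.sum_sub_distrib, Finset.sum_const, Finset.card_univ,
    nsmul_eq_mul]
  field_simp
  simp

theorem fiberSum_mul_right (r : N ⋊[φ] H → ℝ) (a : H) (h : N ⋊[φ] H) :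
    ∑ m : N, r (⟨m, a⟩ * h) = fiberSum r (a * h.right) :=
  Fintype.sum_equiv (Equiv.mulRight (φ a h.left)) _ _ fun _ => rfl

theorem sum_mul_inl_inv_mul (r : N ⋊[φ] H → ℝ) (g h : N ⋊[φ] H) :
    ∑ z : N, r (g * (SemidirectProduct.inl z)⁻¹ * h) = fiberSum r (g.right * h.right) := by
  rw [← fiberSum_mul_right]
  refine Fintype.sum_equiv ((Equiv.inv N).trans ((φ g.right).toEquiv.trans
    (Equiv.mulLeft g.left))) _ _ fun z => ?_
  congr 2
  ext <;> simp

variable [Fintype H]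

noncomputable instance : Fintype (N ⋊[φ] H) := Fintype.ofEquiv _ SemidirectProduct.equivProd.symm

theorem sum_semidirect {M : Type*} [AddCommMonoid M] (f : N ⋊[φ] H → M) :
    ∑ g, f g = ∑ a : H, ∑ m : N, f ⟨m, a⟩ := by
  rw [← Fintype.sum_prod_type_right']
  exact Fintype.sum_equiv SemidirectProduct.equivProd _ _ fun _ => rfl

theorem sum_deviation_sq (r : N ⋊[φ] H → ℝ) :
    ∑ g, deviation r g ^ 2 = ∑ g, r g ^ 2 - (∑ a, fiberSum r a ^ 2) / Fintype.card N := by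
  have hn : (Fintype.card N : ℝ) ≠ 0 := by simp
  rw [sum_semidirect, sum_semidirect, Finset.sum_div, ← Finset.sum_sub_distrib]
  refine Finset.sum_congr rfl fun a _ => ?_
  have h : ∀ m : N, deviation r ⟨m, a⟩ ^ 2 = r ⟨m, a⟩ ^ 2
      - r ⟨m, a⟩ * (2 * fiberSum r a / Fintype.card N) + (fiberSum r a / Fintype.card N) ^ 2 := by
    intro m
    simp only [deviation]
    ring
  simp only [h, Finset.sum_add_distrib, Finset.sum_sub_distrib, ← Finset.sum_mul, Finset.sum_const,
    Finset.card_univ, nsmul_eq_mul]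
  rw [← fiberSum]
  field_simp
  ring

/-- Convolution of real functions on the group. -/
noncomputable def convolve (k f : N ⋊[φ] H → ℝ) (g : N ⋊[φ] H) : ℝ := ∑ h, k (g * h⁻¹) * f h

theorem fiberSum_convolve (k f : N ⋊[φ] H → ℝ) (a : H) :
    fiberSum (convolve k f) a = ∑ h, fiberSum k (a * h⁻¹.right) * f h := by
  simp only [fiberSum, convolve]
  rw [Finset.sum_comm]
  refine Finset.sum_congr rfl fun h _ => ?_
  rw [← Finset.sum_mul, fiberSum_mul_right, fiberSum]

theorem convolve_deviation (k f : N ⋊[φ] H → ℝ) :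
    convolve (deviation k) f = deviation (convolve k f) := by
  funext g
  rw [deviation, fiberSum_convolve]
  simp only [convolve, deviation, Finset.sum_div, ← Finset.sum_sub_distrib]
  refine Finset.sum_congr rfl fun h _ => ?_
  rw [SemidirectProduct.mul_right]
  ring

/-- Convolution by a function whose sums over the cosets of `N` vanish has small operator norm on
a group that is quasirandom on `N`. -/
theorem mul_sum_convolve_sq_le {D : ℝ} (hqr : QuasirandomOn φ D) {k : N ⋊[φ] H → ℝ}
    (hk : ∀ a, fiberSum k a = 0) (f : N ⋊[φ] H → ℝ) :
    D * ∑ g, convolve k f g ^ 2 ≤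
      Fintype.card (N ⋊[φ] H) * (∑ g, k g ^ 2) * ∑ g, f g ^ 2 := by
  classical
  let M : Matrix (N ⋊[φ] H) (N ⋊[φ] H) ℂ := Matrix.of fun g h => (k (g * h⁻¹) : ℂ)
  have hinvA : ∀ a g h, (Mᴴ * M) (g * a) (h * a) = (Mᴴ * M) g h := by
    intro a g h
    simp only [Matrix.mul_apply, Matrix.conjTranspose_apply, Matrix.of_apply, M]
    refine Fintype.sum_equiv (Equiv.mulRight a⁻¹) _ _ fun x => ?_
    simp [mul_assoc]
  have hcomm : ∀ a u, (Mᴴ * M) *ᵥ (rightRegular _ a u) = rightRegular _ a ((Mᴴ * M) *ᵥ u) := by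
    intro a u
    funext g
    change ∑ h, (Mᴴ * M) g h * u (h * a) = ∑ h, (Mᴴ * M) (g * a) h * u h
    refine Fintype.sum_equiv (Equiv.mulRight a) _ _ fun h => ?_
    simp [hinvA]
  have hsum : ∀ u g, ∑ z : N, (Mᴴ *ᵥ u) (g * SemidirectProduct.inl z) = 0 := by
    intro u g
    simp only [Matrix.mulVec, dotProduct, Matrix.conjTranspose_apply, Matrix.of_apply, M]
    rw [Finset.sum_comm]
    refine Finset.sum_eq_zero fun x _ => ?_
    rw [← Finset.sum_mul]
    have h := sum_mul_inl_inv_mul k x g⁻¹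
    rw [hk] at h
    simp only [mul_inv_rev, ← mul_assoc, Complex.star_def, Complex.conj_ofReal]
    rw [← Complex.ofReal_sum, h]
    simp
  have hmult : ∀ μ : ℂ, μ ≠ 0 → Module.End.HasEigenvalue (Matrix.toLin' (Mᴴ * M)) μ →
      D ≤ Module.finrank ℂ (Module.End.eigenspace (Matrix.toLin' (Mᴴ * M)) μ) := by
    intro μ hμ hev
    have hmem : ∀ u, u ∈ Module.End.eigenspace (Matrix.toLin' (Mᴴ * M)) μ ↔
        (Mᴴ * M) *ᵥ u = μ • u := fun u => by
      rw [Module.End.mem_eigenspace_iff, Matrix.toLin'_apply]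
    obtain ⟨U, hUW, hU, hirr⟩ := exists_irreducible_subrepresentation (rightRegular (N ⋊[φ] H))
      (Module.End.eigenspace (Matrix.toLin' (Mᴴ * M)) μ) hev (by
        intro a u hu
        rw [Submodule.mem_comap, hmem, hcomm, (hmem u).1 hu, map_smul])
    have htype : ∃ z : N, (rightRegular (N ⋊[φ] H)).subrepresentation U hU
        (SemidirectProduct.inl z) ≠ 1 := by
      by_contra! hcon
      obtain ⟨⟨u, hu⟩, hu0⟩ := @exists_ne _ hirr.1 0
      refine hu0 (Subtype.ext (funext fun g => ?_))
      have hfix : ∀ z : N, u (g * SemidirectProduct.inl z) = u g := by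
        intro z
        have h := congrArg Subtype.val (LinearMap.congr_fun (hcon z) ⟨u, hu⟩)
        exact congrFun h g
      have hs := hsum (M *ᵥ u) g
      rw [Matrix.mulVec_mulVec, (hmem u).1 (hUW hu)] at hs
      simpa [hfix, hμ] using hs
    exact (hqr U _ hirr htype).trans (by exact_mod_cast Submodule.finrank_mono hUW)
  have hmain := mul_sum_sq_mulVec_le hmult fun g => (f g : ℂ)
  have hconv : ∀ g, ‖(M *ᵥ fun g => (f g : ℂ)) g‖ ^ 2 = convolve k f g ^ 2 := by
    intro g
    have h : (M *ᵥ fun g => (f g : ℂ)) g = (convolve k f g : ℂ) := by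
      simp [Matrix.mulVec, dotProduct, M, convolve]
    rw [h, Complex.norm_real, Real.norm_eq_abs, sq_abs]
  have hHS : ∑ g, ∑ h, ‖M g h‖ ^ 2 = Fintype.card (N ⋊[φ] H) * ∑ g, k g ^ 2 := by
    have h : ∀ g, ∑ h, ‖M g h‖ ^ 2 = ∑ g, k g ^ 2 := by
      intro g
      refine Fintype.sum_equiv ((Equiv.inv _).trans (Equiv.mulLeft g)) _ _ fun h => ?_
      simp [M]
    simp [h]
  simpa only [hconv, hHS, Complex.norm_real, Real.norm_eq_abs, sq_abs] using hmain

theorem card_collisions_mul (X Y : Set (N ⋊[φ] H)) :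
    (Nat.card {p : ((N ⋊[φ] H) × (N ⋊[φ] H)) × ((N ⋊[φ] H) × (N ⋊[φ] H)) //
      p.1.1 ∈ X ∧ p.1.2 ∈ X ∧ p.2.1 ∈ Y ∧ p.2.2 ∈ Y ∧ p.1.1 * p.2.1 = p.1.2 * p.2.2} : ℝ) =
    ∑ g, convolve (X.indicator 1) (Y.indicator 1) g ^ 2 := by
  classical
  rw [card_collisions X Y fun x y => x * y]
  refine Finset.sum_congr rfl fun g _ => ?_
  rw [Finset.sum_comm]
  simp [convolve, ← eq_mul_inv_iff_mul_eq]

theorem card_collisions_right (X Y : Set (N ⋊[φ] H)) :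
    (Nat.card {p : ((N ⋊[φ] H) × (N ⋊[φ] H)) × ((N ⋊[φ] H) × (N ⋊[φ] H)) //
      p.1.1 ∈ X ∧ p.1.2 ∈ X ∧ p.2.1 ∈ Y ∧ p.2.2 ∈ Y ∧
        p.1.1.right * p.2.1.right = p.1.2.right * p.2.2.right} : ℝ) =
    ∑ a, fiberSum (convolve (X.indicator 1) (Y.indicator 1)) a ^ 2 := by
  classical
  rw [card_collisions X Y fun x y => x.right * y.right]
  refine Finset.sum_congr rfl fun a _ => ?_
  rw [Finset.sum_comm, fiberSum_convolve]
  congr 1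
  refine Finset.sum_congr rfl fun h _ => ?_
  rw [sum_semidirect, Finset.sum_eq_single (a * h⁻¹.right)]
  · simp [fiberSum, Finset.sum_mul]
  · intro b _ hb
    refine Finset.sum_eq_zero fun m _ => if_neg fun hab => hb ?_
    rw [← hab]
    simp
  · simp

end Semidirect

/-- **Corollary 1.6.** If `G = N ⋊[φ] H` is `D`-quasirandom on `N`, then for `X, Y ⊆ G`,
`(|H|/|G|)·Ė(X,Y) ≤ E(X,Y) ≤ (|H|/|G|)·Ė(X,Y) + (|G|/D)·|X||Y|`, where
`E(X,Y) = #{(x₁,x₂,y₁,y₂) ∈ X²×Y² : x₁y₁ = x₂y₂}` and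
`Ė(X,Y) = #{(x₁,x₂,y₁,y₂) ∈ X²×Y² : ẋ₁ẏ₁ = ẋ₂ẏ₂}`. -/
theorem energy_semidirect {N H : Type} [Group N] [Group H] [Fintype N] [Fintype H]
    (φ : H →* MulAut N) (D : ℝ) (hD : 0 < D) (hqr : QuasirandomOn φ D)
    (X Y : Set (N ⋊[φ] H)) :
    (Nat.card H : ℝ) / (Nat.card (N ⋊[φ] H) : ℝ) *
          (Nat.card {p : ((N ⋊[φ] H) × (N ⋊[φ] H)) × ((N ⋊[φ] H) × (N ⋊[φ] H)) //
            p.1.1 ∈ X ∧ p.1.2 ∈ X ∧ p.2.1 ∈ Y ∧ p.2.2 ∈ Y ∧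
              p.1.1.right * p.2.1.right = p.1.2.right * p.2.2.right} : ℝ) ≤
        (Nat.card {p : ((N ⋊[φ] H) × (N ⋊[φ] H)) × ((N ⋊[φ] H) × (N ⋊[φ] H)) //
            p.1.1 ∈ X ∧ p.1.2 ∈ X ∧ p.2.1 ∈ Y ∧ p.2.2 ∈ Y ∧
              p.1.1 * p.2.1 = p.1.2 * p.2.2} : ℝ) ∧
      (Nat.card {p : ((N ⋊[φ] H) × (N ⋊[φ] H)) × ((N ⋊[φ] H) × (N ⋊[φ] H)) //
            p.1.1 ∈ X ∧ p.1.2 ∈ X ∧ p.2.1 ∈ Y ∧ p.2.2 ∈ Y ∧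
              p.1.1 * p.2.1 = p.1.2 * p.2.2} : ℝ) ≤
        (Nat.card H : ℝ) / (Nat.card (N ⋊[φ] H) : ℝ) *
            (Nat.card {p : ((N ⋊[φ] H) × (N ⋊[φ] H)) × ((N ⋊[φ] H) × (N ⋊[φ] H)) //
              p.1.1 ∈ X ∧ p.1.2 ∈ X ∧ p.2.1 ∈ Y ∧ p.2.2 ∈ Y ∧
                p.1.1.right * p.2.1.right = p.1.2.right * p.2.2.right} : ℝ) +
          (Nat.card (N ⋊[φ] H) : ℝ) / D * (Nat.card X : ℝ) * (Nat.card Y : ℝ) := by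
  have hratio : (Nat.card H : ℝ) / (Nat.card (N ⋊[φ] H) : ℝ) = (Fintype.card N : ℝ)⁻¹ := by
    have hH : (Fintype.card H : ℝ) ≠ 0 := by simp
    rw [SemidirectProduct.card, Nat.card_eq_fintype_card, Nat.card_eq_fintype_card]
    push_cast
    field_simp
  have hdev := sum_deviation_sq (convolve (X.indicator 1) (Y.indicator (1 : N ⋊[φ] H → ℝ)))
  have hX := sum_deviation_sq (X.indicator (1 : N ⋊[φ] H → ℝ))
  have hbound := mul_sum_convolve_sq_le hqr (fiberSum_deviation (X.indicator 1)) (Y.indicator 1)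
  rw [convolve_deviation, sum_indicator_sq] at hbound
  rw [sum_indicator_sq] at hX
  rw [card_collisions_mul, card_collisions_right, hratio, inv_mul_eq_div]
  have hXle : ∑ g, deviation (X.indicator (1 : N ⋊[φ] H → ℝ)) g ^ 2 ≤ Nat.card X := by
    rw [hX]
    exact sub_le_self _ (by positivity)
  constructor
  · rw [← sub_nonneg, ← hdev]
    positivity
  · rw [← sub_le_iff_le_add', ← hdev, div_mul_eq_mul_div, div_mul_eq_mul_div, le_div_iff₀' hD,
      Nat.card_eq_fintype_card (α := N ⋊[φ] H)]
    exact hbound.trans (by gcongr)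
end

section
/- Let G = N ⋊_φ H be a semidirect product of finite groups that is D-quasirandom on N for some real D > 0. Then for every integer k ≥ 2 and all nonempty subsets X₁, X₂, …, X_k ⊆ G, writing Ṅ_k = #{(x₁,…,x_k,y₁,…,y_k) ∈ (X₁×⋯×X_k)² : ẋ₁ẋ₂⋯ẋ_k = ẏ₁ẏ₂⋯ẏ_k}, the product set satisfies |X₁X₂⋯X_k| ≥ (1/2)·min{ |N|·|X₁|²|X₂|²⋯|X_k|² / Ṅ_k , D^{k−1}·|X₁||X₂|⋯|X_k| / |G|^{k−1} }. -/
open scoped InnerProductSpace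

/-- Right translation of functions on a group. -/
noncomputable def rightTranslation (G : Type) [Group G] [Fintype G] :
    Representation ℂ G (EuclideanSpace ℂ G) where
  toFun g :=
    { toFun := fun F => WithLp.toLp 2 fun x => F (x * g)
      map_add' := fun _ _ => rfl
      map_smul' := fun _ _ => rfl }
  map_one' := by ext F x; simp
  map_mul' g h := by
    ext F x
    exact congrArg F (mul_assoc x g h).symm

theorem rightTranslation_apply {G : Type} [Group G] [Fintype G] (g : G)
    (F : EuclideanSpace ℂ G) (x : G) : rightTranslation G g F x = F (x * g) := rfl

theorem inner_rightTranslation {G : Type} [Group G] [Fintype G] (g : G)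
    (F F' : EuclideanSpace ℂ G) :
    ⟪F, rightTranslation G g F'⟫_ℂ = ⟪rightTranslation G g⁻¹ F, F'⟫_ℂ := by
  simp only [PiLp.inner_apply, rightTranslation_apply]
  refine Fintype.sum_equiv (Equiv.mulRight g) _ _ fun x => ?_
  simp

/-- Left convolution by a function on a group. -/
noncomputable def leftConvolution {G : Type} [Group G] [Fintype G] (f : G → ℂ) :
    EuclideanSpace ℂ G →ₗ[ℂ] EuclideanSpace ℂ G where
  toFun F := WithLp.toLp 2 fun x => ∑ a, f a * F (a⁻¹ * x)
  map_add' F F' := by ext x; simp [mul_add, Finset.sum_add_distrib]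
  map_smul' c F := by
    ext x; simp [Finset.mul_sum, mul_left_comm]

theorem leftConvolution_apply {G : Type} [Group G] [Fintype G] (f : G → ℂ)
    (F : EuclideanSpace ℂ G) (x : G) :
    leftConvolution f F x = ∑ a, f a * F (a⁻¹ * x) := rfl

theorem leftConvolution_rightTranslation {G : Type} [Group G] [Fintype G] (f : G → ℂ) (g : G)
    (F : EuclideanSpace ℂ G) :
    leftConvolution f (rightTranslation G g F) = rightTranslation G g (leftConvolution f F) := by
  ext x
  simp [leftConvolution_apply, rightTranslation_apply, mul_assoc]

/-- The Hilbert–Schmidt norm of left convolution by `f` on an orthonormal family. -/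
theorem sum_norm_leftConvolution_sq_le {G ι : Type} [Group G] [Fintype G] [Fintype ι] (f : G → ℂ)
    {b : ι → EuclideanSpace ℂ G} (hb : Orthonormal ℂ b) :
    ∑ j, ‖leftConvolution f (b j)‖ ^ 2 ≤ Fintype.card G * ∑ a, ‖f a‖ ^ 2 := by
  let row : G → EuclideanSpace ℂ G := fun x => WithLp.toLp 2 fun y => star (f (x * y⁻¹))
  have hrow : ∀ x F, leftConvolution f F x = ⟪row x, F⟫_ℂ := by
    intro x F
    rw [leftConvolution_apply, PiLp.inner_apply]
    refine Fintype.sum_equiv ((Equiv.inv G).trans (Equiv.mulRight x)) _ _ fun a => ?_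
    simp [row, mul_comm]
  have hnorm : ∀ x, ‖row x‖ ^ 2 = ∑ a, ‖f a‖ ^ 2 := by
    intro x
    rw [EuclideanSpace.norm_sq_eq]
    refine Fintype.sum_equiv ((Equiv.inv G).trans (Equiv.mulLeft x)) _ _ fun a => ?_
    simp [row]
  calc ∑ j, ‖leftConvolution f (b j)‖ ^ 2 = ∑ j, ∑ x, ‖⟪b j, row x⟫_ℂ‖ ^ 2 := by
        simp only [EuclideanSpace.norm_sq_eq, hrow, norm_inner_symm]
    _ = ∑ x, ∑ j, ‖⟪b j, row x⟫_ℂ‖ ^ 2 := Finset.sum_comm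
    _ ≤ ∑ x, ‖row x‖ ^ 2 :=
        Finset.sum_le_sum fun x _ => hb.sum_inner_products_le (row x)
    _ = _ := by simp [hnorm]

/-- A linear map attains its operator norm at a singular vector. -/
theorem exists_top_singular_vector {W E : Type} [NormedAddCommGroup W] [InnerProductSpace ℂ W]
    [FiniteDimensional ℂ W] [Nontrivial W] [NormedAddCommGroup E] [InnerProductSpace ℂ E]
    [FiniteDimensional ℂ E] (A : W →ₗ[ℂ] E) :
    ∃ μ : ℝ, (∀ w, ‖A w‖ ^ 2 ≤ μ * ‖w‖ ^ 2) ∧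
      ∃ v ≠ 0, ∀ w, ⟪A w, A v⟫_ℂ = μ * ⟪w, v⟫_ℂ := by
  have hS : (A.adjoint ∘ₗ A).IsSymmetric := fun x y => by
    simp [LinearMap.adjoint_inner_left, LinearMap.adjoint_inner_right]
  have : NeZero (Module.finrank ℂ W) := ⟨Module.finrank_pos.ne'⟩
  let e := hS.eigenvectorBasis rfl
  let μ := hS.eigenvalues rfl
  obtain ⟨i, hi⟩ := Finite.exists_max μ
  have key : ∀ j w, ⟪A w, A (e j)⟫_ℂ = μ j * ⟪w, e j⟫_ℂ := by
    intro j w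
    rw [← LinearMap.adjoint_inner_right]
    have := hS.apply_eigenvectorBasis rfl j
    simp only [LinearMap.comp_apply] at this
    simp only [e, μ, this, inner_smul_right]
    rfl
  refine ⟨μ i, fun w => ?_, e i, e.orthonormal.ne_zero i, key i⟩
  have h1 : ((‖A w‖ ^ 2 : ℝ) : ℂ) = ((∑ j, μ j * ‖⟪e j, w⟫_ℂ‖ ^ 2 : ℝ) : ℂ) := by
    have hw : A w = ∑ j, ⟪e j, w⟫_ℂ • A (e j) := by
      conv_lhs => rw [← e.sum_repr' w]
      simp
    have : ((‖A w‖ ^ 2 : ℝ) : ℂ) = ⟪A w, A w⟫_ℂ := by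
      rw [inner_self_eq_norm_sq_to_K]; simp
    rw [this, congrArg (inner ℂ (A w)) hw, inner_sum]
    push_cast
    refine Finset.sum_congr rfl fun j _ => ?_
    rw [inner_smul_right, key, mul_left_comm, ← inner_conj_symm w, RCLike.mul_conj]
    rfl
  rw [Complex.ofReal_inj.mp h1, ← e.sum_sq_norm_inner_right w, Finset.mul_sum]
  gcongr with j
  exact hi j

/-- If every nonzero translation-invariant subspace of an invariant space `W` has dimension at
least `D`, then left convolution by `f` is small on `W`. -/
theorem norm_leftConvolution_sq_le {G : Type} [Group G] [Fintype G] {D : ℝ} (hD : 0 < D)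
    (W : Submodule ℂ (EuclideanSpace ℂ G))
    (hW : ∀ g, ∀ F ∈ W, rightTranslation G g F ∈ W)
    (hdim : ∀ U ≤ W, U ≠ ⊥ → (∀ g, ∀ F ∈ U, rightTranslation G g F ∈ U) →
      D ≤ Module.finrank ℂ U)
    (f : G → ℂ) {F : EuclideanSpace ℂ G} (hF : F ∈ W) :
    ‖leftConvolution f F‖ ^ 2 ≤ Fintype.card G / D * (∑ a, ‖f a‖ ^ 2) * ‖F‖ ^ 2 := by
  rcases eq_or_ne F 0 with rfl | hF0
  · simp
  have : Nontrivial W := ⟨⟨⟨F, hF⟩, 0, fun h => hF0 (congrArg Subtype.val h)⟩⟩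
  obtain ⟨μ, hμ, v, hv0, hv⟩ := exists_top_singular_vector (W := W)
    (leftConvolution f ∘ₗ W.subtype)
  let U : Submodule ℂ (EuclideanSpace ℂ G) :=
    { carrier := {u | u ∈ W ∧ ∀ w ∈ W,
        ⟪leftConvolution f w, leftConvolution f u⟫_ℂ = μ * ⟪w, u⟫_ℂ}
      add_mem' := fun {u u'} hu hu' => ⟨W.add_mem hu.1 hu'.1, fun w hw => by
        rw [map_add, inner_add_right, inner_add_right, hu.2 w hw, hu'.2 w hw, mul_add]⟩
      zero_mem' := ⟨W.zero_mem, by simp⟩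
      smul_mem' := fun c u hu => ⟨W.smul_mem c hu.1, fun w hw => by
        rw [map_smul, inner_smul_right, inner_smul_right, hu.2 w hw, mul_left_comm]⟩ }
  have hvU : (v : EuclideanSpace ℂ G) ∈ U := ⟨v.2, fun w hw => hv ⟨w, hw⟩⟩
  have hU : D ≤ Module.finrank ℂ U := by
    refine hdim U (fun u hu => hu.1) (fun h => hv0 ?_) fun g u hu => ⟨hW g u hu.1, fun w hw => ?_⟩
    · rw [h] at hvU
      exact Subtype.ext ((Submodule.mem_bot ℂ).mp hvU)
    · rw [leftConvolution_rightTranslation, inner_rightTranslation, inner_rightTranslation,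
        ← leftConvolution_rightTranslation]
      exact hu.2 _ (hW _ w hw)
  let b := stdOrthonormalBasis ℂ U
  have hb : Orthonormal ℂ fun j => (b j : EuclideanSpace ℂ G) :=
    b.orthonormal.comp_linearIsometry U.subtypeₗᵢ
  have hsum := sum_norm_leftConvolution_sq_le f hb
  have hbj : ∀ j, ‖leftConvolution f (b j : EuclideanSpace ℂ G)‖ ^ 2 = μ := by
    intro j
    have h := (b j).2.2 _ (b j).2.1
    rw [inner_self_eq_norm_sq_to_K, inner_self_eq_norm_sq_to_K, hb.1 j] at h
    simp only [Complex.coe_algebraMap, Complex.ofReal_one, one_pow, mul_one] at h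
    exact_mod_cast h
  simp only [hbj, Finset.sum_const, Finset.card_univ, Fintype.card_fin, nsmul_eq_mul] at hsum
  have hμ0 : 0 ≤ μ := by
    have := (sq_nonneg _).trans (hμ v)
    have hpos : 0 < ‖v‖ ^ 2 := by positivity
    exact nonneg_of_mul_nonneg_left this hpos
  refine (hμ ⟨F, hF⟩).trans ?_
  refine mul_le_mul_of_nonneg_right ?_ (sq_nonneg _)
  rw [div_mul_eq_mul_div, le_div_iff₀ hD, mul_comm]
  exact (mul_le_mul_of_nonneg_right hU hμ0).trans hsum

/-- Nonzero translation-invariant spaces of functions with mean zero on each coset of `N` have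
dimension at least `D`. -/
theorem QuasirandomOn.le_finrank {N H : Type} [Group N] [Group H] [Fintype N] {φ : H →* MulAut N}
    [Fintype (N ⋊[φ] H)] {D : ℝ} (hqr : QuasirandomOn φ D)
    (U : Submodule ℂ (EuclideanSpace ℂ (N ⋊[φ] H)))
    (hU : ∀ F ∈ U, ∀ x, ∑ z : N, F (x * SemidirectProduct.inl z) = 0) (hne : U ≠ ⊥)
    (hinv : ∀ g, ∀ F ∈ U, rightTranslation (N ⋊[φ] H) g F ∈ U) :
    D ≤ Module.finrank ℂ U := by
  induction hn : Module.finrank ℂ U using Nat.strong_induction_on generalizing U with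
  | _ n ih =>
  subst hn
  let σ : Representation ℂ (N ⋊[φ] H) U :=
    { toFun := fun g => (rightTranslation (N ⋊[φ] H) g).restrict (hinv g)
      map_one' := by ext F x; simp
      map_mul' := fun g h => by ext F x; simp }
  have hσ : ∀ g (F : U), (σ g F : EuclideanSpace ℂ (N ⋊[φ] H)) =
    rightTranslation (N ⋊[φ] H) g F := fun _ _ => rfl
  by_cases hirr : IsIrreducibleRep σ
  · refine hqr U σ hirr ?_
    by_contra! htriv
    obtain ⟨F, hF, hF0⟩ := U.ne_bot_iff.mp hne
    refine hF0 ?_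
    ext x
    have h := hU F hF x
    have hz : ∀ z : N, F (x * SemidirectProduct.inl z) = F x := by
      intro z
      have := hσ (SemidirectProduct.inl z) ⟨F, hF⟩
      rw [htriv z] at this
      rw [← rightTranslation_apply, ← this]
      rfl
    simpa [hz] using h
  · have hnt : Nontrivial U := Submodule.nontrivial_iff_ne_bot.mpr hne
    simp only [IsIrreducibleRep, hnt, true_and, not_forall, not_or] at hirr
    obtain ⟨W, hW, hbot, htop⟩ := hirr
    have hfr : Module.finrank ℂ (W.map U.subtype) = Module.finrank ℂ W :=
      LinearEquiv.finrank_eq (W.equivMapOfInjective _ U.injective_subtype).symm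
    have hlt : Module.finrank ℂ (W.map U.subtype) < Module.finrank ℂ U := by
      rw [hfr]
      exact Submodule.finrank_lt htop
    refine (ih _ hlt (W.map U.subtype) ?_ ?_ ?_ rfl).trans (by exact_mod_cast hlt.le)
    · rintro _ ⟨F, -, rfl⟩
      exact hU F F.2
    · exact fun h => hbot <| Submodule.map_injective_of_injective U.injective_subtype
        (h.trans (Submodule.map_bot _).symm)
    · rintro g _ ⟨F, hF, rfl⟩
      exact ⟨σ g F, hW g F hF, rfl⟩

/-- The mixing inequality: convolving a function with mean zero on cosets of `N` by the indicator
of `A`. -/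
theorem QuasirandomOn.sum_convolution_sq_le {N H : Type} [Group N] [Group H] [Fintype N] {φ : H →* MulAut N}
    [Fintype (N ⋊[φ] H)] {D : ℝ} (hD : 0 < D) (hqr : QuasirandomOn φ D)
    (A : Finset (N ⋊[φ] H)) (F : N ⋊[φ] H → ℝ)
    (hF : ∀ x, ∑ z : N, F (x * SemidirectProduct.inl z) = 0) :
    ∑ x, (∑ a ∈ A, F (a⁻¹ * x)) ^ 2 ≤
      Fintype.card (N ⋊[φ] H) / D * A.card * ∑ x, F x ^ 2 := by
  classical
  let W : Submodule ℂ (EuclideanSpace ℂ (N ⋊[φ] H)) :=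
    { carrier := {F | ∀ x, ∑ z : N, F (x * SemidirectProduct.inl z) = 0}
      add_mem' := fun {u u'} hu hu' x => by
        simp [Finset.sum_add_distrib, hu x, hu' x]
      zero_mem' := fun x => by simp
      smul_mem' := fun c u hu x => by simp [← Finset.mul_sum, hu x] }
  have hW : ∀ g, ∀ F ∈ W, rightTranslation (N ⋊[φ] H) g F ∈ W := by
    intro g F hF x
    rw [← hF (x * g)]
    simp only [rightTranslation_apply]
    let e : N ≃ N := ((MulAut.conj g.left).toEquiv.symm).trans (φ g.right).toEquiv.symm
    refine Fintype.sum_equiv e _ _ fun z => congrArg F ?_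
    rw [mul_assoc, mul_assoc]
    congr 1
    ext <;> simp [e, mul_assoc]
  have h := norm_leftConvolution_sq_le hD W hW
    (fun U hUW hne hinv => hqr.le_finrank U (fun F hF => hUW hF) hne hinv)
    (fun a => if a ∈ A then 1 else 0)
    (F := WithLp.toLp 2 fun x => (F x : ℂ)) (fun x => by exact_mod_cast hF x)
  rw [EuclideanSpace.norm_sq_eq, EuclideanSpace.norm_sq_eq] at h
  have hconv : ∀ x, ∑ a, (if a ∈ A then 1 else 0) * (F (a⁻¹ * x) : ℂ) =
      ((∑ a ∈ A, F (a⁻¹ * x) : ℝ) : ℂ) := by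
    intro x
    simp [Finset.sum_ite_mem]
  have hind : ∑ a, ‖(if a ∈ A then 1 else 0 : ℂ)‖ ^ 2 = A.card := by
    simp [apply_ite]
  simp only [leftConvolution_apply, hconv, hind, Complex.norm_real, Real.norm_eq_abs,
    sq_abs] at h
  exact h

/-- The number of ways to write `g` as an ordered product of elements of the sets `X i`. -/
def productCount {G : Type} [Group G] [DecidableEq G] {k : ℕ} (X : Fin k → Finset G) (g : G) : ℕ :=
  ((Fintype.piFinset X).filter fun x => (List.ofFn x).prod = g).card

theorem productCount_succ {G : Type} [Group G] [DecidableEq G] {k : ℕ}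
    (X : Fin (k + 1) → Finset G) (g : G) :
    productCount X g = ∑ a ∈ X 0, productCount (fun i => X i.succ) (a⁻¹ * g) := by
  simp only [productCount]
  rw [← Finset.card_sigma]
  refine Finset.card_bij' (fun x _ => ⟨x 0, Fin.tail x⟩) (fun p _ => Fin.cons p.1 p.2) ?_ ?_ ?_ ?_
  · intro x hx
    simp only [Finset.mem_filter, Fintype.mem_piFinset, List.ofFn_succ, List.prod_cons] at hx
    simp only [Finset.mem_sigma, Finset.mem_filter, Fintype.mem_piFinset]
    refine ⟨hx.1 0, fun i => hx.1 i.succ, ?_⟩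
    rw [← hx.2, inv_mul_cancel_left]
    rfl
  · rintro ⟨a, y⟩ hp
    simp only [Finset.mem_sigma, Finset.mem_filter, Fintype.mem_piFinset] at hp
    simp only [Finset.mem_filter, Fintype.mem_piFinset, List.ofFn_succ, List.prod_cons,
      Fin.cons_zero, Fin.cons_succ, hp.2.2, mul_inv_cancel_left, and_true]
    exact Fin.cases hp.1 hp.2.1
  · intro x _
    exact Fin.cons_self_tail x
  · rintro ⟨a, y⟩ _
    simp

theorem productCount_zero {G : Type} [Group G] [DecidableEq G] (X : Fin 0 → Finset G) (g : G) :
    productCount X g = if g = 1 then 1 else 0 := by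
  simp [productCount, Finset.filter_const, eq_comm, apply_ite]

/-- The average of a function over the cosets of `N`. -/
noncomputable def cosetMean {N H : Type} [Group N] [Group H] [Fintype N] {φ : H →* MulAut N}
    (F : N ⋊[φ] H → ℝ) (x : N ⋊[φ] H) : ℝ :=
  (∑ z : N, F (x * SemidirectProduct.inl z)) / Fintype.card N

theorem cosetMean_mul_inl {N H : Type} [Group N] [Group H] [Fintype N] {φ : H →* MulAut N}
    (F : N ⋊[φ] H → ℝ) (x : N ⋊[φ] H) (z : N) :
    cosetMean F (x * SemidirectProduct.inl z) = cosetMean F x := by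
  unfold cosetMean
  congr 1
  refine Fintype.sum_equiv (Equiv.mulLeft z) _ _ fun w => ?_
  simp [mul_assoc]

theorem sum_sub_cosetMean {N H : Type} [Group N] [Group H] [Fintype N] {φ : H →* MulAut N}
    (F : N ⋊[φ] H → ℝ) (x : N ⋊[φ] H) :
    ∑ z : N, (F (x * SemidirectProduct.inl z) - cosetMean F (x * SemidirectProduct.inl z)) = 0 := by
  simp only [cosetMean_mul_inl, Finset.sum_sub_distrib, Finset.sum_const, Finset.card_univ,
    nsmul_eq_mul]
  rw [cosetMean, mul_div_cancel₀ _ (by simp), sub_self]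

/-- Pythagoras for the decomposition into the coset mean and the rest. -/
theorem sum_sq_eq_cosetMean {N H : Type} [Group N] [Group H] [Fintype N] {φ : H →* MulAut N}
    [Fintype (N ⋊[φ] H)] (F : N ⋊[φ] H → ℝ) :
    ∑ x, F x ^ 2 = ∑ x, cosetMean F x ^ 2 + ∑ x, (F x - cosetMean F x) ^ 2 := by
  have hcross : ∑ x, cosetMean F x * (F x - cosetMean F x) = 0 := by
    have hz : ∀ z : N, ∑ x, cosetMean F x * (F x - cosetMean F x) =
        ∑ x, cosetMean F x * (F (x * SemidirectProduct.inl z) -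
          cosetMean F (x * SemidirectProduct.inl z)) := by
      intro z
      refine (Fintype.sum_equiv (Equiv.mulRight (SemidirectProduct.inl z)) _ _ fun x => ?_).symm
      simp [cosetMean_mul_inl]
    have hsum : ∑ _z : N, ∑ x, cosetMean F x * (F x - cosetMean F x) = 0 := by
      rw [Finset.sum_congr rfl fun z _ => hz z, Finset.sum_comm]
      simp only [← Finset.mul_sum, sum_sub_cosetMean, mul_zero, Finset.sum_const_zero]
    simpa using hsum
  have hexp : ∀ x, F x ^ 2 = cosetMean F x ^ 2 + (F x - cosetMean F x) ^ 2 +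
      2 * (cosetMean F x * (F x - cosetMean F x)) := fun x => by ring
  rw [Finset.sum_congr rfl fun x _ => hexp x, Finset.sum_add_distrib, Finset.sum_add_distrib,
    ← Finset.mul_sum, hcross, mul_zero, add_zero]

theorem QuasirandomOn.sum_productCount_sub_cosetMean_sq_le {N H : Type} [Group N] [Group H]
    {φ : H →* MulAut N} [Fintype N] [Fintype (N ⋊[φ] H)] [DecidableEq (N ⋊[φ] H)] {D : ℝ} (hD : 0 < D)
    (hqr : QuasirandomOn φ D) {k : ℕ} (X : Fin (k + 1) → Finset (N ⋊[φ] H)) :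
    ∑ x, ((productCount X x : ℝ) - cosetMean (fun y => (productCount X y : ℝ)) x) ^ 2 ≤
      (Fintype.card (N ⋊[φ] H) / D) ^ k * ∏ i, ((X i).card : ℝ) := by
  induction k with
  | zero =>
    have h := sum_sq_eq_cosetMean fun y => (productCount X y : ℝ)
    have hnonneg : 0 ≤ ∑ x, cosetMean (fun y => (productCount X y : ℝ)) x ^ 2 := by positivity
    have hcount : ∀ x, productCount X x = if x ∈ X 0 then 1 else 0 := by
      intro x
      simp [productCount_succ, productCount_zero, inv_mul_eq_one]
    have hcard : ∑ x, (productCount X x : ℝ) ^ 2 = (X 0).card := by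
      simp [hcount]
    have hprod : ∏ i, ((X i).card : ℝ) = (X 0).card := by simp
    rw [pow_zero, one_mul, hprod]
    linarith
  | succ k ih =>
    let c : N ⋊[φ] H → ℝ := fun y => productCount (fun i => X i.succ) y
    have hsplit : ∀ x, (productCount X x : ℝ) - cosetMean (fun y => (productCount X y : ℝ)) x =
        ∑ a ∈ X 0, (c (a⁻¹ * x) - cosetMean c (a⁻¹ * x)) := by
      intro x
      simp only [cosetMean, productCount_succ X, Nat.cast_sum, Finset.sum_sub_distrib, c]
      rw [Finset.sum_comm, Finset.sum_div]
      simp only [mul_assoc]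
    simp only [hsplit]
    refine (hqr.sum_convolution_sq_le hD (X 0) (fun y => c y - cosetMean c y)
      (sum_sub_cosetMean c)).trans ?_
    rw [Fin.prod_univ_succ, pow_succ']
    have := mul_le_mul_of_nonneg_left (ih fun i => X i.succ)
      (show 0 ≤ (Fintype.card (N ⋊[φ] H) : ℝ) / D * (X 0).card by positivity)
    refine this.trans_eq ?_
    ring

theorem sum_productCount_mul_inl {N H : Type} [Group N] [Group H] [Fintype N] {φ : H →* MulAut N}
    [DecidableEq H] [DecidableEq (N ⋊[φ] H)] {k : ℕ} (X : Fin k → Finset (N ⋊[φ] H))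
    (x : N ⋊[φ] H) :
    ∑ z : N, productCount X (x * SemidirectProduct.inl z) =
      ((Fintype.piFinset X).filter fun y =>
        (List.ofFn fun i => (y i).right).prod = x.right).card := by
  classical
  simp only [productCount, Finset.card_filter]
  rw [Finset.sum_comm]
  refine Finset.sum_congr rfl fun y _ => ?_
  have hright : (List.ofFn fun i => (y i).right).prod = (List.ofFn y).prod.right := by
    have := map_list_prod (SemidirectProduct.rightHom : N ⋊[φ] H →* H) (List.ofFn y)
    rw [List.map_ofFn] at this
    exact this.symm
  rw [hright]
  generalize (List.ofFn y).prod = g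
  split_ifs with hg
  · have hz : ∀ z : N, g = x * SemidirectProduct.inl z ↔
        (φ x.right).symm (x.left⁻¹ * g.left) = z := by
      intro z
      rw [SemidirectProduct.ext_iff, MulEquiv.symm_apply_eq, inv_mul_eq_iff_eq_mul]
      simp [hg]
    simp [hz]
  · refine Finset.sum_eq_zero fun z _ => if_neg ?_
    rintro rfl
    simp at hg

theorem sum_card_fiber_sq {α β : Type} [Fintype β] [DecidableEq β] (P : Finset α) (r : α → β) :
    ∑ h, (P.filter fun y => r y = h).card ^ 2 =
      ((P ×ˢ P).filter fun p => r p.1 = r p.2).card := by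
  rw [Finset.card_eq_sum_card_fiberwise (f := fun p => r p.2) (t := Finset.univ) (by simp)]
  refine Finset.sum_congr rfl fun h _ => ?_
  rw [sq, ← Finset.card_product, ← Finset.filter_product, Finset.filter_filter]
  congr 1
  ext p
  simp only [Finset.mem_filter]
  grind

/-- The energy of the coset mean of `productCount X` counts collisions in `H`. -/
theorem sum_cosetMean_productCount_sq {N H : Type} [Group N] [Group H] [Fintype N] [Fintype H]
    {φ : H →* MulAut N} [Fintype (N ⋊[φ] H)] [DecidableEq H] [DecidableEq (N ⋊[φ] H)] {k : ℕ}
    (X : Fin k → Finset (N ⋊[φ] H)) :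
    ∑ x, cosetMean (fun y => (productCount X y : ℝ)) x ^ 2 =
      (((Fintype.piFinset X ×ˢ Fintype.piFinset X).filter fun p =>
        (List.ofFn fun i => (p.1 i).right).prod =
          (List.ofFn fun i => (p.2 i).right).prod).card : ℝ) / Fintype.card N := by
  simp only [cosetMean, ← Nat.cast_sum, sum_productCount_mul_inl]
  rw [← sum_card_fiber_sq (Fintype.piFinset X) fun y => (List.ofFn fun i => (y i).right).prod]
  refine (Fintype.sum_equiv SemidirectProduct.equivProd _ (fun p : N × H =>
    ((((Fintype.piFinset X).filter fun y =>
        (List.ofFn fun i => (y i).right).prod = p.2).card : ℝ) / Fintype.card N) ^ 2)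
    fun x => rfl).trans ?_
  rw [Fintype.sum_prod_type]
  have hN : (Fintype.card N : ℝ) ≠ 0 := by simp
  simp only [div_pow, Finset.sum_const, Finset.card_univ, nsmul_eq_mul, ← Finset.sum_div]
  push_cast
  field_simp

/-- Cauchy–Schwarz: the size of a product set is controlled by its energy. -/
theorem prod_card_sq_le {G : Type} [Group G] [Fintype G] [DecidableEq G] {k : ℕ}
    (X : Fin k → Finset G) :
    (∏ i, ((X i).card : ℝ)) ^ 2 ≤
      (((Fintype.piFinset X).image fun x => (List.ofFn x).prod).card : ℝ) *
        ∑ g, (productCount X g : ℝ) ^ 2 := by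
  have h := Finset.card_eq_sum_card_image (fun x => (List.ofFn x).prod) (Fintype.piFinset X)
  rw [Fintype.card_piFinset] at h
  rw [← Nat.cast_prod, h, Nat.cast_sum]
  refine sq_sum_le_card_mul_sum_sq.trans ?_
  gcongr
  exact Finset.sum_le_sum_of_subset_of_nonneg (Finset.subset_univ _) fun _ _ _ => sq_nonneg _

theorem half_min_le_of_sq_le {S P n g d c : ℝ} (hP : 0 < P) (hn : 0 < n) (hg : 0 < g)
    (hd : 0 < d) (hc : 0 ≤ c) (h : P ^ 2 ≤ S * (c / n + g / d * P)) :
    1 / 2 * min (n * P ^ 2 / c) (d * P / g) ≤ S := by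
  have hB : 0 < g / d * P := by positivity
  have hA : 0 ≤ c / n := by positivity
  have h1 : min (n * P ^ 2 / c) (d * P / g) * (c / n) ≤ P ^ 2 := by
    refine (mul_le_mul_of_nonneg_right (min_le_left _ _) hA).trans ?_
    rcases hc.eq_or_lt with rfl | hc
    · simpa using sq_nonneg P
    · exact le_of_eq (by field_simp)
  have h2 : min (n * P ^ 2 / c) (d * P / g) * (g / d * P) ≤ P ^ 2 := by
    refine (mul_le_mul_of_nonneg_right (min_le_right _ _) hB.le).trans ?_
    exact le_of_eq (by field_simp)
  refine le_of_mul_le_mul_right ?_ (add_pos_of_nonneg_of_pos hA hB)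
  linarith

/-- **Theorem 1.7.** If `G = N ⋊[φ] H` is `D`-quasirandom on `N`, then for `k ≥ 2` and
nonempty `X₁, …, X_k ⊆ G`,
`|X₁X₂⋯X_k| ≥ (1/2)·min{ |N|·|X₁|²⋯|X_k|²/Ṅ_k , D^(k-1)·|X₁|⋯|X_k|/|G|^(k-1) }`,
where `Ṅ_k` counts pairs of tuples with `ẋ₁⋯ẋ_k = ẏ₁⋯ẏ_k` in `H`. -/
theorem product_growth_semidirect {N H : Type} [Group N] [Group H] [Fintype N] [Fintype H]
    (φ : H →* MulAut N) (D : ℝ) (hD : 0 < D) (hqr : QuasirandomOn φ D)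
    (k : ℕ) (hk : 2 ≤ k) (X : Fin k → Set (N ⋊[φ] H)) (hX : ∀ i, (X i).Nonempty) :
    (Nat.card {g : N ⋊[φ] H |
        ∃ x : Fin k → N ⋊[φ] H, (∀ i, x i ∈ X i) ∧ (List.ofFn x).prod = g} : ℝ) ≥
      (1 / 2) * min
        ((Nat.card N : ℝ) * (∏ i, (Nat.card (X i) : ℝ) ^ 2) /
          (Nat.card {p : (Fin k → N ⋊[φ] H) × (Fin k → N ⋊[φ] H) //
            (∀ i, p.1 i ∈ X i) ∧ (∀ i, p.2 i ∈ X i) ∧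
              (List.ofFn fun i => (p.1 i).right).prod =
                (List.ofFn fun i => (p.2 i).right).prod} : ℝ))
        (D ^ (k - 1) * (∏ i, (Nat.card (X i) : ℝ)) /
          (Nat.card (N ⋊[φ] H) : ℝ) ^ (k - 1)) := by
  classical
  have : Fintype (N ⋊[φ] H) := Fintype.ofEquiv _ SemidirectProduct.equivProd.symm
  obtain ⟨Y, rfl⟩ : ∃ Y : Fin k → Finset (N ⋊[φ] H), X = fun i => (Y i : Set (N ⋊[φ] H)) :=
    ⟨fun i => (X i).toFinset, by simp⟩
  obtain ⟨k, rfl⟩ : ∃ m, k = m + 1 := ⟨k - 1, by omega⟩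
  have hS : Nat.card {g : N ⋊[φ] H | ∃ x : Fin (k + 1) → N ⋊[φ] H,
      (∀ i, x i ∈ (Y i : Set (N ⋊[φ] H))) ∧ (List.ofFn x).prod = g} =
      ((Fintype.piFinset Y).image fun x => (List.ofFn x).prod).card := by
    rw [Nat.card_coe_set_eq, ← Set.ncard_coe_finset]
    congr 1
    ext g
    simp
  have hcoll : Nat.card {p : (Fin (k + 1) → N ⋊[φ] H) × (Fin (k + 1) → N ⋊[φ] H) //
      (∀ i, p.1 i ∈ (Y i : Set (N ⋊[φ] H))) ∧ (∀ i, p.2 i ∈ (Y i : Set (N ⋊[φ] H))) ∧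
        (List.ofFn fun i => (p.1 i).right).prod = (List.ofFn fun i => (p.2 i).right).prod} =
      ((Fintype.piFinset Y ×ˢ Fintype.piFinset Y).filter fun p =>
        (List.ofFn fun i => (p.1 i).right).prod =
          (List.ofFn fun i => (p.2 i).right).prod).card := by
    refine Nat.subtype_card _ fun p => ?_
    simp [and_assoc]
  have hY : ∀ i, Nat.card (Y i : Set (N ⋊[φ] H)) = (Y i).card := fun i => by
    rw [Nat.card_coe_set_eq, Set.ncard_coe_finset]
  simp only [hS, hcoll, hY, Nat.card_eq_fintype_card, Finset.prod_pow, add_tsub_cancel_right]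
  have hCS := prod_card_sq_le Y
  rw [sum_sq_eq_cosetMean, sum_cosetMean_productCount_sq] at hCS
  have hmix := hqr.sum_productCount_sub_cosetMean_sq_le hD Y
  have hP : 0 < ∏ i, ((Y i).card : ℝ) := Finset.prod_pos fun i _ => by
    exact_mod_cast Finset.card_pos.mpr (by simpa using hX i)
  have hN : (0 : ℝ) < Fintype.card N := by exact_mod_cast Fintype.card_pos
  have hG : (0 : ℝ) < Fintype.card (N ⋊[φ] H) := by exact_mod_cast Fintype.card_pos
  have hS0 : (0 : ℝ) ≤ ((Fintype.piFinset Y).image fun x => (List.ofFn x).prod).card :=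
    Nat.cast_nonneg _
  exact half_min_le_of_sq_le hP hN (pow_pos hG k) (pow_pos hD k) (Nat.cast_nonneg _)
    (hCS.trans (mul_le_mul_of_nonneg_left (add_le_add_right (by rwa [div_pow] at hmix) _) hS0))
end
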